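/- arXiv:1001.0344 — 7 statements merged into one kernel-verified Lean document; each statement's English description precedes it below -/
import Mathlib

section
/- Let H₀ and W be self-adjoint linear operators on a finite-dimensional complex inner product space, and suppose W is relatively bounded by H₀ with constant b ≥ 0. Then for every eigenvalue λ of H₀ + W there exists an eigenvalue λ₀ of H₀ such that (λ₀ − λ)² ≤ b²·λ₀²; equivalently, λ lies in the closed interval with endpoints λ₀(1 − b) and λ₀(1 + b). -/
/-- For a symmetric operator `T`, a nonzero vector `ψ` with `‖T ψ - μ ψ‖ ≤ b ‖T ψ‖` forces
some eigenvalue `t` of `T` to satisfy `(t - μ)² ≤ b² t²`. -/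
theorem LinearMap.IsSymmetric.exists_hasEigenvalue_sub_sq_le
    {V : Type*} [NormedAddCommGroup V] [InnerProductSpace ℂ V] [FiniteDimensional ℂ V]
    {T : V →ₗ[ℂ] V} (hT : T.IsSymmetric) {b μ : ℝ} {ψ : V} (hψ : ψ ≠ 0)
    (h : ‖T ψ - (μ : ℂ) • ψ‖ ≤ b * ‖T ψ‖) :
    ∃ t : ℝ, Module.End.HasEigenvalue T (t : ℂ) ∧ (t - μ) ^ 2 ≤ b ^ 2 * t ^ 2 := by
  let B := hT.eigenvectorBasis rfl
  let e := hT.eigenvalues rfl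
  have hB (i) : B.repr (T ψ) i = (e i : ℂ) * B.repr ψ i :=
    hT.eigenvectorBasis_apply_self_apply rfl ψ i
  have norm_T : ‖T ψ‖ ^ 2 = ∑ i, e i ^ 2 * ‖B.repr ψ i‖ ^ 2 := by
    rw [← B.repr.norm_map, EuclideanSpace.norm_sq_eq]
    refine Finset.sum_congr rfl fun i _ => ?_
    rw [hB, norm_mul, mul_pow, Complex.norm_real, Real.norm_eq_abs, sq_abs]
  have norm_sub : ‖T ψ - (μ : ℂ) • ψ‖ ^ 2 = ∑ i, (e i - μ) ^ 2 * ‖B.repr ψ i‖ ^ 2 := by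
    rw [← B.repr.norm_map, EuclideanSpace.norm_sq_eq]
    refine Finset.sum_congr rfl fun i _ => ?_
    rw [map_sub, map_smul, PiLp.sub_apply, PiLp.smul_apply, smul_eq_mul, hB, ← sub_mul,
      ← Complex.ofReal_sub, norm_mul, mul_pow, Complex.norm_real, Real.norm_eq_abs, sq_abs]
  by_contra! hlt
  have hlt' (i) : b ^ 2 * e i ^ 2 < (e i - μ) ^ 2 := hlt (e i) (hT.hasEigenvalue_eigenvalues rfl i)
  obtain ⟨i, hi⟩ : ∃ i, B.repr ψ i ≠ 0 := by
    by_contra! h0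
    exact hψ (B.repr.map_eq_zero_iff.mp (PiLp.ext h0))
  have hsum : ∑ i, b ^ 2 * (e i ^ 2 * ‖B.repr ψ i‖ ^ 2) <
      ∑ i, (e i - μ) ^ 2 * ‖B.repr ψ i‖ ^ 2 := by
    refine Finset.sum_lt_sum (fun j _ => ?_) ⟨i, Finset.mem_univ i, ?_⟩
    · rw [← mul_assoc]
      exact mul_le_mul_of_nonneg_right (hlt' j).le (by positivity)
    · rw [← mul_assoc]
      exact mul_lt_mul_of_pos_right (hlt' i) (by positivity)
  rw [← Finset.mul_sum, ← norm_T, ← norm_sub, ← mul_pow] at hsum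
  exact hsum.not_ge (pow_le_pow_left₀ (norm_nonneg _) h 2)

/-- A point whose squared distance to `t` is at most `b² t²` lies between `t (1 - b)` and
`t (1 + b)`. -/
theorem mem_uIcc_of_sub_sq_le {t x b : ℝ} (h : (t - x) ^ 2 ≤ b ^ 2 * t ^ 2) :
    x ∈ Set.uIcc (t * (1 - b)) (t * (1 + b)) := by
  have habs : |t - x| ≤ |b * t| := sq_le_sq.mp (by rwa [mul_pow])
  rw [Set.mem_uIcc]
  rcases abs_cases (b * t) with ⟨hbt, _⟩ | ⟨hbt, _⟩ <;> rw [hbt, abs_le] at habs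
  · left
    constructor <;> linarith
  · right
    constructor <;> linarith


/-- If the self-adjoint operator `W` is relatively bounded by the self-adjoint
operator `H₀` with constant `b ≥ 0`, then every eigenvalue `λ` of `H₀ + W` satisfies
`(λ₀ − λ)² ≤ b²·λ₀²` for some eigenvalue `λ₀` of `H₀`; equivalently `λ` lies in the closed
interval with endpoints `λ₀(1 − b)` and `λ₀(1 + b)`. -/
theorem relatively_bounded_spectrum
    {V : Type*} [NormedAddCommGroup V] [InnerProductSpace ℂ V] [FiniteDimensional ℂ V]
    (H₀ W : V →L[ℂ] V) (hH₀ : IsSelfAdjoint H₀) (hW : IsSelfAdjoint W)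
    (b : ℝ) (hb : 0 ≤ b) (hrel : ∀ ψ : V, ‖W ψ‖ ≤ b * ‖H₀ ψ‖)
    (lam : ℝ)
    (hlam : Module.End.HasEigenvalue ((H₀ + W : V →L[ℂ] V) : V →ₗ[ℂ] V) (lam : ℂ)) :
    ∃ lam₀ : ℝ, Module.End.HasEigenvalue (H₀ : V →ₗ[ℂ] V) (lam₀ : ℂ) ∧
      (lam₀ - lam) ^ 2 ≤ b ^ 2 * lam₀ ^ 2 ∧
      lam ∈ Set.uIcc (lam₀ * (1 - b)) (lam₀ * (1 + b)) := by
  obtain ⟨ψ, hψ⟩ := hlam.exists_hasEigenvector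
  have hsum : H₀ ψ + W ψ = (lam : ℂ) • ψ := hψ.apply_eq_smul
  have hsub : H₀ ψ - (lam : ℂ) • ψ = -W ψ := by
    rw [← hsum]
    abel
  have hbound : ‖H₀ ψ - (lam : ℂ) • ψ‖ ≤ b * ‖H₀ ψ‖ := by
    rw [hsub, norm_neg]
    exact hrel ψ
  obtain ⟨t, ht, hle⟩ := hH₀.isSymmetric.exists_hasEigenvalue_sub_sq_le hψ.2 hbound
  exact ⟨t, ht, hle, mem_uIcc_of_sub_sq_le hle⟩
end

section
/- Let H₀ be a self-adjoint operator on a finite-dimensional complex inner product space, W any operator on the same space, b ≥ 0, λ ∈ ℝ, and ψ ≠ 0 a vector with (H₀ + W)ψ = λψ and ‖Wψ‖ ≤ b‖H₀ψ‖. Then there exists an eigenvalue λ₀ of H₀ such that (λ₀ − λ)² ≤ b²·λ₀². -/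
/-- If `ψ ≠ 0` is an eigenvector of `H₀ + W` with (real) eigenvalue `λ` and
`‖Wψ‖ ≤ b‖H₀ψ‖`, then there is an eigenvalue `λ₀` of the self-adjoint operator `H₀` with
`(λ₀ − λ)² ≤ b²·λ₀²`. -/
theorem eigenvalue_close_to_unperturbed
    {V : Type*} [NormedAddCommGroup V] [InnerProductSpace ℂ V] [FiniteDimensional ℂ V]
    (H₀ : V →L[ℂ] V) (hH₀ : IsSelfAdjoint H₀) (W : V →L[ℂ] V)
    (b : ℝ) (hb : 0 ≤ b) (lam : ℝ) (ψ : V) (hψ : ψ ≠ 0)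
    (heig : (H₀ + W) ψ = (lam : ℂ) • ψ)
    (hrel : ‖W ψ‖ ≤ b * ‖H₀ ψ‖) :
    ∃ lam₀ : ℝ, Module.End.HasEigenvalue (H₀ : V →ₗ[ℂ] V) (lam₀ : ℂ) ∧
      (lam₀ - lam) ^ 2 ≤ b ^ 2 * lam₀ ^ 2 := by
  have hT : (H₀ : V →ₗ[ℂ] V).IsSymmetric := hH₀.isSymmetric
  by_contra! hfar
  let e := hT.eigenvectorBasis rfl
  let μ := hT.eigenvalues rfl
  have norm_sq (x : V) : ‖x‖ ^ 2 = ∑ i, ‖e.repr x i‖ ^ 2 := by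
    rw [← e.repr.norm_map x, EuclideanSpace.norm_sq_eq]
  have hH (i) : e.repr (H₀ ψ) i = (μ i : ℂ) * e.repr ψ i :=
    hT.eigenvectorBasis_apply_self_apply rfl ψ i
  have hW : W ψ = (lam : ℂ) • ψ - H₀ ψ := by
    rw [← heig, add_apply, add_sub_cancel_left]
  have hWi (i) : ‖e.repr (W ψ) i‖ ^ 2 = (μ i - lam) ^ 2 * ‖e.repr ψ i‖ ^ 2 := by
    have h : e.repr (W ψ) i = ((lam - μ i : ℝ) : ℂ) * e.repr ψ i := by
      rw [hW, map_sub, map_smul, PiLp.sub_apply, PiLp.smul_apply, hH, smul_eq_mul]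
      push_cast
      ring
    rw [h, norm_mul, mul_pow, Complex.norm_real, Real.norm_eq_abs, sq_abs]
    ring
  have hHi (i) : ‖e.repr (H₀ ψ) i‖ ^ 2 = μ i ^ 2 * ‖e.repr ψ i‖ ^ 2 := by
    rw [hH, norm_mul, mul_pow, Complex.norm_real, Real.norm_eq_abs, sq_abs]
  have hgap (i) : b ^ 2 * μ i ^ 2 < (μ i - lam) ^ 2 :=
    hfar (μ i) (hT.hasEigenvalue_eigenvalues rfl i)
  obtain ⟨j, hj⟩ : ∃ j, e.repr ψ j ≠ 0 := by
    by_contra! h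
    exact hψ (e.repr.map_eq_zero_iff.mp (PiLp.ext h))
  have hlt : b ^ 2 * ‖H₀ ψ‖ ^ 2 < ‖W ψ‖ ^ 2 := by
    rw [norm_sq, norm_sq, Finset.mul_sum]
    simp only [hWi, hHi, ← mul_assoc]
    refine Finset.sum_lt_sum (fun i _ => ?_) ⟨j, Finset.mem_univ j, ?_⟩
    · exact mul_le_mul_of_nonneg_right (hgap i).le (sq_nonneg _)
    · exact mul_lt_mul_of_pos_right (hgap j) (pow_pos (norm_pos_iff.mpr hj) 2)
  have hle : ‖W ψ‖ ^ 2 ≤ b ^ 2 * ‖H₀ ψ‖ ^ 2 := by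
    rw [← mul_pow]
    exact pow_le_pow_left₀ (norm_nonneg _) hrel 2
  exact hle.not_gt hlt
end

section
/- Let H₀ be a positive-semidefinite self-adjoint operator on a finite-dimensional complex inner product space, let P be the orthogonal projection onto the kernel of H₀ and Q = 1 − P. Let W be an operator that is relatively bounded by H₀ with constant b, 0 ≤ b < 1. Then for every operator S on the same space, ‖Q(SW − WS)P‖ ≤ b·‖Q(SH₀ − H₀S)P‖, where ‖·‖ is the operator norm. -/
/-- Let `H₀` be positive semidefinite, `P` the orthogonal projection onto
`ker H₀` (characterized as a self-adjoint idempotent whose fixed points are exactly `ker H₀`),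
`Q = 1 − P`, and let `W` be relatively bounded by `H₀` with constant `0 ≤ b < 1`.  Then for any
operator `S`, `‖Q[S,W]P‖ ≤ b‖Q[S,H₀]P‖`. -/
theorem commutator_bound_of_relatively_bounded
    {V : Type*} [NormedAddCommGroup V] [InnerProductSpace ℂ V] [FiniteDimensional ℂ V]
    (H₀ : V →L[ℂ] V) (hH₀ : H₀.IsPositive)
    (P : V →L[ℂ] V) (hPsa : IsSelfAdjoint P) (hPidem : P ∘L P = P)
    (hPker : ∀ ψ : V, P ψ = ψ ↔ H₀ ψ = 0)
    (W : V →L[ℂ] V) (b : ℝ) (hb0 : 0 ≤ b) (hb1 : b < 1)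
    (hrel : ∀ ψ : V, ‖W ψ‖ ≤ b * ‖H₀ ψ‖)
    (S : V →L[ℂ] V) :
    ‖(1 - P) ∘L (S ∘L W - W ∘L S) ∘L P‖ ≤ b * ‖(1 - P) ∘L (S ∘L H₀ - H₀ ∘L S) ∘L P‖ := by
  have hHP : ∀ x, H₀ (P x) = 0 := fun x => (hPker _).1 (DFunLike.congr_fun hPidem x)
  have hWP : ∀ x, W (P x) = 0 := fun x => by simpa [hHP] using hrel (P x)
  have hPH : ∀ x, P (H₀ x) = 0 := fun x => by
    refine ext_inner_right ℂ fun y => ?_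
    rw [hPsa.isSymmetric.apply_clm, hH₀.isSymmetric.apply_clm, hHP, inner_zero_right, inner_zero_left]
  have hQ : ∀ x, ‖(1 - P) x‖ ≤ ‖x‖ := fun x => by
    have hproj : IsStarProjection (1 - P) := IsStarProjection.one_sub ⟨hPidem, hPsa⟩
    simpa using (1 - P).le_of_opNorm_le hproj.norm_le x
  refine ContinuousLinearMap.opNorm_le_bound _ (by positivity) fun x => ?_
  calc ‖((1 - P) ∘L (S ∘L W - W ∘L S) ∘L P) x‖
      = ‖(1 - P) (W (S (P x)))‖ := by simp [hWP, ← norm_neg (W (S (P x)) - P (W (S (P x))))]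
    _ ≤ ‖W (S (P x))‖ := hQ _
    _ ≤ b * ‖H₀ (S (P x))‖ := hrel _
    _ = b * ‖((1 - P) ∘L (S ∘L H₀ - H₀ ∘L S) ∘L P) x‖ := by simp [hHP, hPH]
    _ ≤ b * (‖(1 - P) ∘L (S ∘L H₀ - H₀ ∘L S) ∘L P‖ * ‖x‖) := by
      gcongr
      exact ContinuousLinearMap.le_opNorm _ x
    _ = b * ‖(1 - P) ∘L (S ∘L H₀ - H₀ ∘L S) ∘L P‖ * ‖x‖ := (mul_assoc _ _ _).symm
end

section
/- Let a and b be finite types and let M, M' : Matrix (a × b) (a × b) ℂ be positive-semidefinite Hermitian matrices, with partial traces ρ = Tr₂(M) and ρ' = Tr₂(M'). Assume the kernel of ρ is contained in the kernel of ρ', i.e. for every vector v : a → ℂ, ρ.mulVec v = 0 implies ρ'.mulVec v = 0. Then for every matrix O : Matrix a a ℂ, (O ⊗ₖ 1) * M = 0 implies (O ⊗ₖ 1) * M' = 0. -/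
open Matrix
open scoped Kronecker ComplexOrder

/-- The partial trace over the second tensor factor:
`(Tr₂ M) i j = ∑ k, M (i,k) (j,k)`. -/
noncomputable def ptrace2 {a b : Type*} [Fintype b] (M : Matrix (a × b) (a × b) ℂ) : Matrix a a ℂ :=
  Matrix.of fun i j => ∑ k : b, M (i, k) (j, k)

/-- The partial trace is left-linear over matrices acting on the first factor. -/
theorem ptrace2_kronecker_one_mul {a b : Type*} [Fintype a] [Fintype b] [DecidableEq b]
    (O : Matrix a a ℂ) (M : Matrix (a × b) (a × b) ℂ) :
    ptrace2 ((O ⊗ₖ (1 : Matrix b b ℂ)) * M) = O * ptrace2 M := by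
  ext i j
  simp only [ptrace2, of_apply, mul_apply, kroneckerMap_apply, one_apply, Fintype.sum_prod_type,
    mul_ite, mul_one, mul_zero, ite_mul, zero_mul, Finset.sum_ite_eq, Finset.mem_univ, if_true,
    Finset.mul_sum]
  exact Finset.sum_comm

/-- The partial trace commutes with the conjugate transpose. -/
theorem conjTranspose_ptrace2 {a b : Type*} [Fintype b] (M : Matrix (a × b) (a × b) ℂ) :
    (ptrace2 M)ᴴ = ptrace2 Mᴴ := by
  ext i j
  simp [ptrace2]

/-- The partial trace preserves the trace. -/
theorem trace_ptrace2 {a b : Type*} [Fintype a] [Fintype b] (M : Matrix (a × b) (a × b) ℂ) :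
    (ptrace2 M).trace = M.trace := by
  simp [ptrace2, trace, Fintype.sum_prod_type]

open scoped MatrixOrder Matrix.Norms.L2Operator in
/-- A positive semidefinite `M` is annihilated by `O ⊗ₖ 1` as soon as its partial trace is
annihilated by `O`. -/
theorem kronecker_one_mul_eq_zero_of_mul_ptrace2_eq_zero {a b : Type*} [Fintype a] [Fintype b]
    [DecidableEq b] {M : Matrix (a × b) (a × b) ℂ} (hM : M.PosSemidef) {O : Matrix a a ℂ}
    (h : O * ptrace2 M = 0) : (O ⊗ₖ (1 : Matrix b b ℂ)) * M = 0 := by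
  classical
  have htrace : ((O ⊗ₖ (1 : Matrix b b ℂ)) * M * (O ⊗ₖ (1 : Matrix b b ℂ))ᴴ).trace = 0 := by
    rw [trace_mul_comm, conjTranspose_kronecker, conjTranspose_one, ← trace_ptrace2,
      ptrace2_kronecker_one_mul, ptrace2_kronecker_one_mul, h, mul_zero, trace_zero]
  obtain ⟨B, rfl⟩ := CStarAlgebra.nonneg_iff_eq_star_mul_self.mp hM.nonneg
  rw [star_eq_conjTranspose] at htrace ⊢
  have hB : (O ⊗ₖ (1 : Matrix b b ℂ)) * Bᴴ = 0 := by
    rw [← trace_mul_conjTranspose_self_eq_zero_iff, conjTranspose_mul, conjTranspose_conjTranspose]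
    simpa only [Matrix.mul_assoc] using htrace
  rw [← Matrix.mul_assoc, hB, Matrix.zero_mul]

/-- If `M, M'` are positive semidefinite with `ker (Tr₂ M) ⊆ ker (Tr₂ M')`,
then `(O ⊗ 1) M = 0` implies `(O ⊗ 1) M' = 0`. -/
theorem kernel_ptrace_annihilation
    {a b : Type*} [Fintype a] [Fintype b] [DecidableEq a] [DecidableEq b]
    (M M' : Matrix (a × b) (a × b) ℂ) (hM : M.PosSemidef) (hM' : M'.PosSemidef)
    (hker : ∀ v : a → ℂ, (ptrace2 M).mulVec v = 0 → (ptrace2 M').mulVec v = 0)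
    (O : Matrix a a ℂ) (hO : (O ⊗ₖ (1 : Matrix b b ℂ)) * M = 0) :
    (O ⊗ₖ (1 : Matrix b b ℂ)) * M' = 0 := by
  have hρ : ptrace2 M * Oᴴ = 0 := by
    have h := congrArg conjTranspose (ptrace2_kronecker_one_mul O M)
    rw [hO, conjTranspose_mul, conjTranspose_ptrace2, conjTranspose_ptrace2, hM.isHermitian.eq,
      conjTranspose_zero] at h
    rw [← h]
    ext i j
    simp [ptrace2]
  have hρ' : ptrace2 M' * Oᴴ = 0 := by
    ext i j
    exact congrFun (hker (fun k => Oᴴ k j) (funext fun i => congrFun (congrFun hρ i) j)) i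
  refine kronecker_one_mul_eq_zero_of_mul_ptrace2_eq_zero hM' ?_
  rw [← conjTranspose_eq_zero, conjTranspose_mul, conjTranspose_ptrace2, hM'.isHermitian.eq, hρ']
end

section
/- Let μ ∈ ℝ, β ∈ ℝ, α > 0, J > 0, and let a : ℕ → ℝ be a sequence with 0 ≤ a(r) ≤ J · r^(−β) · e^(−μr) for all integers r ≥ 1. Then for every ε with 0 < ε < 1, setting δ = J^(ε/α) and c = (α/e)^α, one has a(r) ≤ c · J^(1−ε) · r^(−(α+β)) · e^(−(μ−δ)r) for all integers r ≥ 1. -/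
/-- The function `t ↦ t ^ α * exp (-t)` on `t ≥ 0` is bounded by its value `(α / e) ^ α` at `α`. -/
theorem rpow_le_div_exp_rpow_mul_exp {α t : ℝ} (hα : 0 < α) (ht : 0 ≤ t) :
    t ^ α ≤ (α / Real.exp 1) ^ α * Real.exp t := by
  have hexp : Real.exp t = Real.exp (t / α) ^ α := by
    rw [← Real.exp_mul, div_mul_cancel₀ _ hα.ne']
  rw [hexp, ← Real.mul_rpow (by positivity) (by positivity)]
  refine Real.rpow_le_rpow ht ?_ hα.le
  have h := Real.add_one_le_exp (t / α - 1)
  rw [sub_add_cancel, Real.exp_sub, div_le_iff₀ hα] at h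
  exact h.trans_eq (by ring)

/-- **Degree Reset, quantitative form.** If `0 ≤ a r ≤ J·r^(−β)·e^(−μr)` for all
`r ≥ 1`, then for `0 < ε < 1`, with `δ = J^(ε/α)` and `c = (α/e)^α`,
`a r ≤ c·J^(1−ε)·r^(−(α+β))·e^(−(μ−δ)r)` for all `r ≥ 1`. -/
theorem degree_reset
    (μ β α J : ℝ) (hα : 0 < α) (hJ : 0 < J)
    (a : ℕ → ℝ)
    (ha : ∀ r : ℕ, 1 ≤ r → 0 ≤ a r ∧ a r ≤ J * (r : ℝ) ^ (-β) * Real.exp (-μ * r))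
    (ε : ℝ) (hε0 : 0 < ε) (hε1 : ε < 1) :
    ∀ r : ℕ, 1 ≤ r →
      a r ≤ (α / Real.exp 1) ^ α * J ^ (1 - ε) * (r : ℝ) ^ (-(α + β)) *
        Real.exp (-(μ - J ^ (ε / α)) * r) := by
  intro r hr
  have hr0 : (0 : ℝ) < r := by exact_mod_cast hr
  have key := rpow_le_div_exp_rpow_mul_exp hα
    (mul_nonneg (Real.rpow_nonneg hJ.le (ε / α)) hr0.le)
  rw [Real.mul_rpow (by positivity) hr0.le, ← Real.rpow_mul hJ.le,
    div_mul_cancel₀ _ hα.ne'] at key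
  have hJε : J ^ ε * J ^ (1 - ε) = J := by
    rw [← Real.rpow_add hJ, add_sub_cancel, Real.rpow_one]
  have hrα : (r : ℝ) ^ α * (r : ℝ) ^ (-(α + β)) = (r : ℝ) ^ (-β) := by
    rw [← Real.rpow_add hr0]
    congr 1
    ring
  have hexp : Real.exp (-(μ - J ^ (ε / α)) * r) =
      Real.exp (J ^ (ε / α) * r) * Real.exp (-μ * r) := by
    rw [← Real.exp_add]
    congr 1
    ring
  calc a r ≤ J * (r : ℝ) ^ (-β) * Real.exp (-μ * r) := (ha r hr).2
    _ = (J ^ ε * (r : ℝ) ^ α) *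
        (J ^ (1 - ε) * (r : ℝ) ^ (-(α + β)) * Real.exp (-μ * r)) := by
      rw [← hrα]
      nth_rewrite 1 [← hJε]
      ring
    _ ≤ ((α / Real.exp 1) ^ α * Real.exp (J ^ (ε / α) * r)) *
        (J ^ (1 - ε) * (r : ℝ) ^ (-(α + β)) * Real.exp (-μ * r)) := by
      gcongr
    _ = _ := by
      rw [hexp]
      ring
end

section
/- For all real numbers β ≥ 2 and α ≥ β + 4 there exists a constant c > 0 such that for every integer r ≥ 2, the sum ∑_{q=1}^{r−1} q^(4−α) · (r−q)^(−β) is at most c · r^(−β). -/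
theorem Real.rpow_neg_mul_rpow_neg_le {a b s : ℝ} (ha : 0 < a) (hb : 0 < b) (hs : 0 ≤ s) :
    a ^ (-s) * b ^ (-s) ≤ 2 ^ s * (a + b) ^ (-s) * (a ^ (-s) + b ^ (-s)) := by
  wlog hab : a ≤ b generalizing a b
  · simpa only [mul_comm, add_comm] using this hb ha (le_of_not_ge hab)
  have half_rpow : ((a + b) / 2) ^ (-s) = 2 ^ s * (a + b) ^ (-s) := by
    rw [Real.div_rpow (by positivity) zero_le_two, Real.rpow_neg zero_le_two, div_inv_eq_mul,
      mul_comm]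
  have hb_le : b ^ (-s) ≤ 2 ^ s * (a + b) ^ (-s) :=
    half_rpow ▸ Real.rpow_le_rpow_of_nonpos (by positivity) (by linarith) (by linarith)
  calc a ^ (-s) * b ^ (-s) ≤ a ^ (-s) * (2 ^ s * (a + b) ^ (-s)) := by gcongr
    _ = 2 ^ s * (a + b) ^ (-s) * a ^ (-s) := mul_comm _ _
    _ ≤ 2 ^ s * (a + b) ^ (-s) * (a ^ (-s) + b ^ (-s)) := by
      gcongr
      exact le_add_of_nonneg_right (by positivity)

/-- For `β ≥ 2` and `α ≥ β + 4` there is a constant `c > 0` such that for every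
integer `r ≥ 2`, `∑_{q=1}^{r−1} q^(4−α)·(r−q)^(−β) ≤ c·r^(−β)`. -/
theorem weighted_convolution_sum_bound
    (β α : ℝ) (hβ : 2 ≤ β) (hα : β + 4 ≤ α) :
    ∃ c : ℝ, 0 < c ∧ ∀ r : ℕ, 2 ≤ r →
      ∑ q ∈ Finset.Ico 1 r, (q : ℝ) ^ ((4 : ℝ) - α) * ((r - q : ℕ) : ℝ) ^ (-β) ≤
        c * (r : ℝ) ^ (-β) := by
  have hsum : Summable fun n : ℕ => (n : ℝ) ^ (-β) := Real.summable_nat_rpow.mpr (by linarith)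
  set S : ℝ := ∑' n : ℕ, (n : ℝ) ^ (-β)
  have hS : 0 < S := hsum.tsum_pos (fun n => by positivity) 1 (by simp)
  refine ⟨2 ^ β * (S + S), by positivity, fun r _ => ?_⟩
  have hle : ∑ q ∈ Finset.Ico 1 r, (q : ℝ) ^ (-β) ≤ S :=
    hsum.sum_le_tsum _ fun n _ => by positivity
  have hreflect : ∑ q ∈ Finset.Ico 1 r, ((r - q : ℕ) : ℝ) ^ (-β) =
      ∑ q ∈ Finset.Ico 1 r, (q : ℝ) ^ (-β) := by
    simpa using Finset.sum_Ico_reflect (fun n : ℕ => (n : ℝ) ^ (-β)) 1 (Nat.le_succ r)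
  calc ∑ q ∈ Finset.Ico 1 r, (q : ℝ) ^ ((4 : ℝ) - α) * ((r - q : ℕ) : ℝ) ^ (-β)
      ≤ ∑ q ∈ Finset.Ico 1 r,
          2 ^ β * (r : ℝ) ^ (-β) * ((q : ℝ) ^ (-β) + ((r - q : ℕ) : ℝ) ^ (-β)) := by
        refine Finset.sum_le_sum fun q hq => ?_
        obtain ⟨hq1, hqr⟩ := Finset.mem_Ico.mp hq
        have hadd : (q : ℝ) + ((r - q : ℕ) : ℝ) = r := by
          exact_mod_cast Nat.add_sub_cancel' hqr.le
        have hexp : (q : ℝ) ^ ((4 : ℝ) - α) ≤ (q : ℝ) ^ (-β) :=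
          Real.rpow_le_rpow_of_exponent_le (by exact_mod_cast hq1) (by linarith)
        have hmul := Real.rpow_neg_mul_rpow_neg_le (a := q) (b := ((r - q : ℕ) : ℝ)) (s := β)
          (by exact_mod_cast hq1) (by exact_mod_cast Nat.sub_pos_of_lt hqr) (by linarith)
        rw [hadd] at hmul
        exact (mul_le_mul_of_nonneg_right hexp (by positivity)).trans hmul
    _ = 2 ^ β * (r : ℝ) ^ (-β) * (∑ q ∈ Finset.Ico 1 r, (q : ℝ) ^ (-β) +
          ∑ q ∈ Finset.Ico 1 r, (q : ℝ) ^ (-β)) := by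
        rw [← Finset.mul_sum, Finset.sum_add_distrib, hreflect]
    _ ≤ 2 ^ β * (r : ℝ) ^ (-β) * (S + S) := by gcongr
    _ = 2 ^ β * (S + S) * (r : ℝ) ^ (-β) := by ring
end

section
/- Let p ≥ 2 and q ≥ 1 be integers, and let A = (Icc a₁ (a₁+p−1)) ×ˢ (Icc a₂ (a₂+p−1)) and B = (Icc b₁ (b₁+q−1)) ×ˢ (Icc b₂ (b₂+q−1)) be squares in ℤ × ℤ of side lengths p and q respectively, with A ∩ B ≠ ∅. Then there exist c₁, c₂ ∈ ℤ such that the square C = (Icc c₁ (c₁+p+q−1)) ×ˢ (Icc c₂ (c₂+p+q−1)) of side length p+q satisfies both A ∪ B ⊆ C and: every point u ∈ ℤ × ℤ at ℓ∞-distance at most 1 from B (i.e. such that there is v ∈ B with max(|u₁−v₁|, |u₂−v₂|) ≤ 1) belongs to C. -/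
/-- If an `p × p` square `A` and a `q × q` square `B` in `ℤ × ℤ` (products of
integer intervals, `p ≥ 2`, `q ≥ 1`) overlap, then there is a `(p+q) × (p+q)` square `C`
containing `A ∪ B` together with every point at `ℓ∞`-distance at most `1` from `B`. -/
theorem covering_square_exists
    (p q a₁ a₂ b₁ b₂ : ℤ) (hp : 2 ≤ p) (hq : 1 ≤ q)
    (hAB : ((Finset.Icc a₁ (a₁ + p - 1) ×ˢ Finset.Icc a₂ (a₂ + p - 1)) ∩
            (Finset.Icc b₁ (b₁ + q - 1) ×ˢ Finset.Icc b₂ (b₂ + q - 1))).Nonempty) :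
    ∃ c₁ c₂ : ℤ,
      ((Finset.Icc a₁ (a₁ + p - 1) ×ˢ Finset.Icc a₂ (a₂ + p - 1)) ∪
        (Finset.Icc b₁ (b₁ + q - 1) ×ˢ Finset.Icc b₂ (b₂ + q - 1)) ⊆
        Finset.Icc c₁ (c₁ + p + q - 1) ×ˢ Finset.Icc c₂ (c₂ + p + q - 1)) ∧
      ∀ u : ℤ × ℤ,
        (∃ v ∈ Finset.Icc b₁ (b₁ + q - 1) ×ˢ Finset.Icc b₂ (b₂ + q - 1),
          max |u.1 - v.1| |u.2 - v.2| ≤ 1) →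
        u ∈ Finset.Icc c₁ (c₁ + p + q - 1) ×ˢ Finset.Icc c₂ (c₂ + p + q - 1) := by
  obtain ⟨w, hw⟩ := hAB
  simp only [Finset.mem_inter, Finset.mem_product, Finset.mem_Icc] at hw
  refine ⟨min a₁ (b₁ - 1), min a₂ (b₂ - 1), fun u hu => ?_, ?_⟩
  · simp only [Finset.mem_union, Finset.mem_product, Finset.mem_Icc] at hu ⊢
    omega
  · rintro u ⟨v, hv, huv⟩
    simp only [Finset.mem_product, Finset.mem_Icc, max_le_iff, abs_le] at hv huv ⊢
    omega
end
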